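/- Let H be a real Hilbert space, let x_1,…,x_n ∈ H with Gram matrix G_{ts} = ⟨x_t, x_s⟩, and let v_1,…,v_r ∈ ℝⁿ be orthonormal eigenvectors of G with eigenvalues μ_1,…,μ_r > 0. Define φ_j = μ_j^{-1/2} Σ_{t=1}^n v_{jt} x_t for j ∈ {1,…,r}, the estimated factors γ̂_t = √n (v_{1t},…,v_{rt})ᵀ ∈ ℝ^r for t ∈ {1,…,n}, and the estimated loadings q_k = n^{-1} Σ_{t=1}^n (γ̂_t)_k x_t ∈ H for k ∈ {1,…,r}. Then for all a, b ∈ H, n^{-1} Σ_{t=1}^n ⟨x_t − Σ_{k=1}^r (γ̂_t)_k q_k, a⟩ · ⟨x_t − Σ_{k=1}^r (γ̂_t)_k q_k, b⟩ = n^{-1} Σ_{t=1}^n ⟨x_t, a⟩⟨x_t, b⟩ − Σ_{j=1}^r (μ_j/n) ⟨φ_j, a⟩⟨φ_j, b⟩. -/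

import Mathlib

open scoped RealInnerProductSpace

/-- The residuals of two real vectors after projection onto the span of an orthonormal family
have dot product equal to that of the vectors minus that of their coordinates. -/
theorem sum_residual_mul_residual {ι κ : Type*} [Fintype ι] [Fintype κ] [DecidableEq κ]
    (v : κ → ι → ℝ) (hv : ∀ j k, ∑ t, v j t * v k t = if j = k then 1 else 0) (A B : ι → ℝ) :
    ∑ t, (A t - ∑ k, v k t * ∑ s, v k s * A s) * (B t - ∑ k, v k t * ∑ s, v k s * B s) =
      ∑ t, A t * B t - ∑ k, (∑ s, v k s * A s) * ∑ s, v k s * B s := by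
  have pair (C : ι → ℝ) (c : κ → ℝ) :
      ∑ t, C t * ∑ k, v k t * c k = ∑ k, (∑ s, v k s * C s) * c k := by
    simp_rw [Finset.mul_sum, Finset.sum_mul]
    rw [Finset.sum_comm]
    exact Finset.sum_congr rfl fun k _ => Finset.sum_congr rfl fun t _ => by ring
  have coord (c : κ → ℝ) (k : κ) : ∑ s, v k s * ∑ j, v j s * c j = c k := by
    simp [pair, hv]
  have orth (k : κ) : ∑ s, v k s * (A s - ∑ j, v j s * ∑ t, v j t * A t) = 0 := by
    simp_rw [mul_sub, Finset.sum_sub_distrib]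
    rw [coord, sub_self]
  calc
    _ = ∑ t, (A t - ∑ k, v k t * ∑ s, v k s * A s) * B t := by
      simp_rw [mul_sub _ (B _), Finset.sum_sub_distrib]
      rw [pair]
      simp [orth]
    _ = _ := by
      simp_rw [mul_comm _ (B _), mul_sub, Finset.sum_sub_distrib]
      rw [pair]
      simp_rw [mul_comm]

/-- **Proposition 3** (equivalence of the FPOET estimator and the least-squares
substitution estimator).  With `v_1, …, v_r` orthonormal eigenvectors of the Gram matrix
`G_{ts} = ⟨x_t, x_s⟩` with positive eigenvalues `μ_j`, eigenfunctions
`φ_j = μ_j^{-1/2} Σ_t v_{jt} x_t`, estimated factors `γ̂_t = √n (v_{1t},…,v_{rt})ᵀ` and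
loadings `q_k = n⁻¹ Σ_t (γ̂_t)_k x_t`, the residual covariance equals the principal
orthogonal complement:  for all `a, b ∈ H`,
`n⁻¹ Σ_t ⟨x_t − Σ_k (γ̂_t)_k q_k, a⟩⟨x_t − Σ_k (γ̂_t)_k q_k, b⟩
  = n⁻¹ Σ_t ⟨x_t, a⟩⟨x_t, b⟩ − Σ_j (μ_j/n) ⟨φ_j, a⟩⟨φ_j, b⟩`. -/
theorem statement_8 {H : Type*} [NormedAddCommGroup H] [InnerProductSpace ℝ H]
    (n r : ℕ) (x : Fin n → H) (G : Matrix (Fin n) (Fin n) ℝ)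
    (hG : ∀ t s, G t s = ⟪x t, x s⟫)
    (v : Fin r → Fin n → ℝ)
    (hortho : ∀ j k, ∑ t, v j t * v k t = if j = k then 1 else 0)
    (μ : Fin r → ℝ) (hμ : ∀ j, 0 < μ j)
    (heig : ∀ j, G.mulVec (v j) = μ j • v j)
    (φ : Fin r → H) (hφ : ∀ j, φ j = (Real.sqrt (μ j))⁻¹ • ∑ t, v j t • x t)
    (γ : Fin n → Fin r → ℝ) (hγ : ∀ t k, γ t k = Real.sqrt n * v k t)
    (q : Fin r → H) (hq : ∀ k, q k = (n : ℝ)⁻¹ • ∑ t, γ t k • x t) :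
    ∀ a b : H,
      (n : ℝ)⁻¹ * ∑ t, (⟪x t - ∑ k, γ t k • q k, a⟫ * ⟪x t - ∑ k, γ t k • q k, b⟫) =
        (n : ℝ)⁻¹ * ∑ t, ⟪x t, a⟫ * ⟪x t, b⟫ -
          ∑ j, (μ j / n) * (⟪φ j, a⟫ * ⟪φ j, b⟫) := by
  intro a b
  have fit (c : H) (t : Fin n) : ⟪x t - ∑ k, γ t k • q k, c⟫ =
      ⟪x t, c⟫ - ∑ k, v k t * ∑ s, v k s * ⟪x s, c⟫ := by
    have hn : (n : ℝ) ≠ 0 := Nat.cast_ne_zero.mpr t.pos.ne'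
    simp_rw [inner_sub_left, sum_inner, hq, hγ, real_inner_smul_left, sum_inner,
      real_inner_smul_left, mul_assoc, ← Finset.mul_sum]
    congr 1
    rw [Finset.mul_sum]
    refine Finset.sum_congr rfl fun k _ => ?_
    field_simp
    rw [Real.sq_sqrt n.cast_nonneg]
    field_simp
  have score (j : Fin r) : μ j / n * (⟪φ j, a⟫ * ⟪φ j, b⟫) =
      (n : ℝ)⁻¹ * ((∑ s, v j s * ⟪x s, a⟫) * ∑ s, v j s * ⟪x s, b⟫) := by
    have hs : Real.sqrt (μ j) ^ 2 = μ j := Real.sq_sqrt (hμ j).le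
    have h0 : μ j ≠ 0 := (hμ j).ne'
    simp_rw [hφ, real_inner_smul_left, sum_inner, real_inner_smul_left]
    have h1 : μ j * ((Real.sqrt (μ j))⁻¹ * (Real.sqrt (μ j))⁻¹) = 1 := by
      rw [← mul_inv, ← sq, hs, mul_inv_cancel₀ h0]
    linear_combination ((n : ℝ)⁻¹ * ((∑ s, v j s * ⟪x s, a⟫) * ∑ s, v j s * ⟪x s, b⟫)) * h1
  simp_rw [fit, score, ← Finset.mul_sum, ← mul_sub]
  rw [sum_residual_mul_residual v hortho]
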